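/- arXiv:2008.06824 — 2 statements merged into one kernel-verified Lean document; each statement's English description precedes it below -/
import Mathlib

section
/- A finite structure with k distinguished elements has a finite frontier with respect to the class of all finite structures (over the same schema, with k distinguished elements) if and only if it is homomorphically equivalent to a c-acyclic structure, if and only if its core is c-acyclic. -/
/-- A finite relational structure over a schema `S` (with arity function `ar`)
with `k` distinguished elements. -/
structure PStruct (S : Type) (ar : S → ℕ) (k : ℕ) : Type 1 where
  dom : Type
  finite : Finite dom
  facts : ∀ R : S, Set (Fin (ar R) → dom)
  dist : Fin k → dom

attribute [instance] PStruct.finite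

namespace PStruct

variable {S : Type} {ar : S → ℕ} {k : ℕ}

/-- `h` is a homomorphism from `A` to `B`: it preserves all facts and maps
distinguished elements to corresponding distinguished elements. -/
def IsHom (A B : PStruct S ar k) (h : A.dom → B.dom) : Prop :=
  (∀ (R : S) (t : Fin (ar R) → A.dom), t ∈ A.facts R → (fun i => h (t i)) ∈ B.facts R) ∧
  ∀ i : Fin k, h (A.dist i) = B.dist i

/-- `(A,𝐚) → (B,𝐛)`: a homomorphism exists. -/
def HomTo (A B : PStruct S ar k) : Prop := ∃ h, IsHom A B h

/-- Homomorphic equivalence. -/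
def HomEquiv (A B : PStruct S ar k) : Prop := HomTo A B ∧ HomTo B A

/-- Direct product of two structures with distinguished elements. -/
def prod (A B : PStruct S ar k) : PStruct S ar k where
  dom := A.dom × B.dom
  finite := inferInstance
  facts R := {t | (fun i => (t i).1) ∈ A.facts R ∧ (fun i => (t i).2) ∈ B.facts R}
  dist i := (A.dist i, B.dist i)

/-- The facts of a structure, as a type. -/
def Fact (A : PStruct S ar k) : Type := Σ R : S, {t : Fin (ar R) → A.dom // t ∈ A.facts R}

/-- Occurrences of elements in facts: a fact together with a position in it. -/
def Occ (A : PStruct S ar k) : Type :=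
  Σ R : S, {t : Fin (ar R) → A.dom // t ∈ A.facts R} × Fin (ar R)

def Occ.fact {A : PStruct S ar k} (o : Occ A) : Fact A := ⟨o.1, o.2.1⟩

def Occ.elem {A : PStruct S ar k} (o : Occ A) : A.dom := o.2.1.1 o.2.2

/-- Vertices of the (subdivided) incidence graph: elements, occurrences, and facts.
Each occurrence vertex subdivides one edge of the bipartite incidence multigraph,
so that cycles (resp. connectivity) of the incidence multigraph correspond exactly to
cycles (resp. connectivity) of this simple graph. -/
def IncV (A : PStruct S ar k) : Type := A.dom ⊕ (Occ A ⊕ Fact A)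

/-- The incidence graph of a structure, as a simple graph (with each
element-occurrence-in-a-fact edge of the incidence multigraph subdivided). -/
def incGraph (A : PStruct S ar k) : SimpleGraph (IncV A) where
  Adj v w := ∃ o : Occ A,
    (v = Sum.inl o.elem ∧ w = Sum.inr (Sum.inl o)) ∨
    (w = Sum.inl o.elem ∧ v = Sum.inr (Sum.inl o)) ∨
    (v = Sum.inr (Sum.inl o) ∧ w = Sum.inr (Sum.inr o.fact)) ∨
    (w = Sum.inr (Sum.inl o) ∧ v = Sum.inr (Sum.inr o.fact))
  symm := by
    refine ⟨?_⟩
    rintro v w ⟨o, h⟩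
    exact ⟨o, by tauto⟩
  loopless := by
    refine ⟨?_⟩
    rintro v ⟨o, (⟨h1, h2⟩ | ⟨h1, h2⟩ | ⟨h1, h2⟩ | ⟨h1, h2⟩)⟩ <;> rw [h1] at h2 <;>
      first
      | cases h2
      | · rw [Sum.inr.injEq] at h2
          cases h2

/-- A structure is acyclic if its incidence graph is acyclic (Berge acyclicity). -/
def Acyclic (A : PStruct S ar k) : Prop := (incGraph A).IsAcyclic

/-- A structure is c-acyclic if every cycle of its incidence graph passes through
a distinguished element. -/
def CAcyclic (A : PStruct S ar k) : Prop :=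
  ∀ (v : IncV A) (c : (incGraph A).Walk v v), c.IsCycle →
    ∃ i : Fin k, Sum.inl (A.dist i) ∈ c.support

/-- A structure is c-connected if every connected component of its incidence graph
contains a distinguished element. -/
def CConnected (A : PStruct S ar k) : Prop :=
  ∀ v : IncV A, ∃ i : Fin k, (incGraph A).Reachable (Sum.inl (A.dist i)) v

/-- The incidence graph is connected. -/
def IncConnected (A : PStruct S ar k) : Prop := (incGraph A).Connected

/-- The fact graph: vertices are facts, with an edge between distinct facts that
share a non-distinguished element. -/
def factGraph (A : PStruct S ar k) : SimpleGraph (Fact A) where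
  Adj f g := f ≠ g ∧ ∃ b : A.dom, (∀ i, b ≠ A.dist i) ∧ (∃ j, f.2.1 j = b) ∧ (∃ j, g.2.1 j = b)
  symm := by
    refine ⟨?_⟩
    rintro f g ⟨hne, b, h1, h2, h3⟩
    exact ⟨hne.symm, b, h1, h3, h2⟩
  loopless := by refine ⟨?_⟩; rintro f ⟨hne, -⟩; exact hne rfl

/-- A structure is fg-connected if its fact graph is connected. -/
def FgConnected (A : PStruct S ar k) : Prop := (factGraph A).Connected

/-- A structure is a core if it admits no homomorphism to a proper substructure,
i.e. every endomorphism is surjective on elements and on facts. -/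
def IsCore (A : PStruct S ar k) : Prop :=
  ∀ h : A.dom → A.dom, IsHom A A h →
    Function.Surjective h ∧
    ∀ (R : S) (t : Fin (ar R) → A.dom), t ∈ A.facts R →
      ∃ s ∈ A.facts R, (fun i => h (s i)) = t

/-- Unique Names Property: the distinguished elements are pairwise distinct. -/
def UNP (A : PStruct S ar k) : Prop := Function.Injective A.dist

/-- A structure is safe if every distinguished element occurs in at least one fact. -/
def Safe (A : PStruct S ar k) : Prop :=
  ∀ i : Fin k, ∃ (R : S) (t : Fin (ar R) → A.dom), t ∈ A.facts R ∧ ∃ j, t j = A.dist i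

/-- A structure is (the canonical structure of) a conjunctive query iff every element
occurs in at least one fact (in particular it is safe). -/
def IsCQ (A : PStruct S ar k) : Prop :=
  ∀ x : A.dom, ∃ (R : S) (t : Fin (ar R) → A.dom), t ∈ A.facts R ∧ ∃ j, t j = x

/-- The size of a structure: its number of facts. -/
noncomputable def size (A : PStruct S ar k) : ℕ := Nat.card (Fact A)

/-- The total size of a set of structures: the sum of (size + 1) over its members. -/
noncomputable def totalSize (F : Set (PStruct S ar k)) : ℕ := ∑ᶠ B ∈ F, (size B + 1)

/-- `F` is a frontier for `A` with respect to the class `C`. -/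
def IsFrontier (C : Set (PStruct S ar k)) (A : PStruct S ar k)
    (F : Set (PStruct S ar k)) : Prop :=
  F.Finite ∧
  (∀ B ∈ F, HomTo B A) ∧
  (∀ B ∈ F, ¬ HomTo A B) ∧
  ∀ C' ∈ C, HomTo C' A → ¬ HomTo A C' → ∃ B ∈ F, HomTo C' B

/-- `D` is a finite duality for `A` with respect to the class `C`. -/
def IsDuality (C : Set (PStruct S ar k)) (A : PStruct S ar k)
    (D : Set (PStruct S ar k)) : Prop :=
  D.Finite ∧ ∀ C' ∈ C, (HomTo A C' ↔ ∀ B ∈ D, ¬ HomTo C' B)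

/-- A conjunctive query (given by its canonical structure `Q`) fits the example sets
`(E⁺, E⁻)`: every example in `E⁺` is positive and every example in `E⁻` is negative.
(By Chandra–Merlin, `(A,𝐚)` is a positive example for `Q` iff `Q → (A,𝐚)`.) -/
def Fits (Q : PStruct S ar k) (Ep Em : Set (PStruct S ar k)) : Prop :=
  (∀ E ∈ Ep, HomTo Q E) ∧ (∀ E ∈ Em, ¬ HomTo Q E)

/-- `(E⁺, E⁻)` uniquely characterizes the CQ `Q` with respect to the class `C` of CQs
(all represented by their canonical structures): `Q` fits, and every member of `C`
that fits is logically equivalent (i.e. homomorphically equivalent) to `Q`. -/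
def UniquelyCharacterizes (Ep Em : Set (PStruct S ar k)) (Q : PStruct S ar k)
    (C : Set (PStruct S ar k)) : Prop :=
  Fits Q Ep Em ∧ ∀ Q' ∈ C, Fits Q' Ep Em → HomEquiv Q Q'

end PStruct

namespace PStruct

variable {S : Type} {ar : S → ℕ} {k : ℕ}

/-! ### Basic facts about homomorphisms -/

theorem IsHom.comp {A B C : PStruct S ar k} {g : B.dom → C.dom} {f : A.dom → B.dom}
    (hg : IsHom B C g) (hf : IsHom A B f) : IsHom A C (fun x => g (f x)) :=
  ⟨fun R t ht => hg.1 R _ (hf.1 R t ht), fun i => by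
    change g (f (A.dist i)) = C.dist i
    rw [hf.2, hg.2]⟩

theorem isHom_id (A : PStruct S ar k) : IsHom A A (fun x => x) :=
  ⟨fun _ _ ht => ht, fun _ => rfl⟩

theorem HomTo.trans {A B C : PStruct S ar k} (h₁ : HomTo A B) (h₂ : HomTo B C) : HomTo A C := by
  obtain ⟨f, hf⟩ := h₁
  obtain ⟨g, hg⟩ := h₂
  exact ⟨_, hg.comp hf⟩

theorem HomTo.refl (A : PStruct S ar k) : HomTo A A := ⟨_, isHom_id A⟩

theorem HomEquiv.symm {A B : PStruct S ar k} (h : HomEquiv A B) : HomEquiv B A := ⟨h.2, h.1⟩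

theorem IsFrontier.of_homEquiv {A B : PStruct S ar k} {F : Set (PStruct S ar k)}
    (h : HomEquiv A B) (hF : IsFrontier Set.univ A F) : IsFrontier Set.univ B F := by
  obtain ⟨h1, h2, h3, h4⟩ := hF
  refine ⟨h1, fun D hD => (h2 D hD).trans h.1, fun D hD hB => h3 D hD (h.1.trans hB), ?_⟩
  intro C hC hCB hBC
  exact h4 C hC (hCB.trans h.2) fun hAC => hBC (h.2.trans hAC)

theorem homTo_prod {A B C : PStruct S ar k} (h₁ : HomTo C A) (h₂ : HomTo C B) :
    HomTo C (prod A B) := by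
  obtain ⟨f, hf⟩ := h₁
  obtain ⟨g, hg⟩ := h₂
  exact ⟨fun x => (f x, g x), fun R t ht => ⟨hf.1 R t ht, hg.1 R t ht⟩,
    fun i => Prod.ext (hf.2 i) (hg.2 i)⟩

theorem prod_fst (A B : PStruct S ar k) : HomTo (prod A B) A :=
  ⟨fun x => x.1, fun _ _ ht => ht.1, fun _ => rfl⟩

theorem prod_snd (A B : PStruct S ar k) : HomTo (prod A B) B :=
  ⟨fun x => x.2, fun _ _ ht => ht.2, fun _ => rfl⟩

/-! ### Existence of cores -/

/-- The substructure induced on a set containing the distinguished elements. -/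
def sub (A : PStruct S ar k) (s : Set A.dom) (hs : ∀ i, A.dist i ∈ s) : PStruct S ar k where
  dom := s
  finite := inferInstance
  facts R := {t | (fun i => (t i : A.dom)) ∈ A.facts R}
  dist i := ⟨A.dist i, hs i⟩

theorem exists_core (A : PStruct S ar k) : ∃ B, IsCore B ∧ HomEquiv A B := by
  classical
  have hex : ∃ n, ∃ B : PStruct S ar k, HomEquiv A B ∧ Nat.card B.dom = n :=
    ⟨_, A, ⟨HomTo.refl A, HomTo.refl A⟩, rfl⟩
  obtain ⟨B, hAB, hB⟩ := Nat.find_spec hex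
  refine ⟨B, ?_, hAB⟩
  intro h hh
  have hsurj : Function.Surjective h := by
    by_contra hns
    let B' := sub B (Set.range h) fun i => ⟨B.dist i, hh.2 i⟩
    have h1 : HomTo B B' := ⟨fun x => ⟨h x, x, rfl⟩, fun R t ht => hh.1 R t ht,
      fun i => Subtype.ext (hh.2 i)⟩
    have h2 : HomTo B' B := ⟨fun x => x.1, fun R t ht => ht, fun i => rfl⟩
    have hlt : Nat.card B'.dom < Nat.card B.dom := by
      change Nat.card (Set.range h) < _
      rw [Nat.card_coe_set_eq, ← Set.ncard_univ]
      apply Set.ncard_lt_ncard _ (Set.toFinite _)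
      rw [Set.ssubset_univ_iff]
      intro h; exact hns (Set.range_eq_univ.mp h)
    rw [hB] at hlt
    exact Nat.find_min hex hlt ⟨B', ⟨hAB.1.trans h1, h2.trans hAB.2⟩, rfl⟩
  refine ⟨hsurj, ?_⟩
  intro R t ht
  have hinj : Function.Injective h := Finite.injective_iff_surjective.mpr hsurj
  let φ : B.facts R → B.facts R := fun s => ⟨fun i => h (s.1 i), hh.1 R s.1 s.2⟩
  have hφ : Function.Injective φ := by
    intro s s' hss
    apply Subtype.ext
    funext i
    exact hinj (congrFun (congrArg Subtype.val hss) i)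
  obtain ⟨s, hs⟩ := Finite.injective_iff_surjective.mp hφ ⟨t, ht⟩
  exact ⟨s.1, s.2, congrArg Subtype.val hs⟩

/-! ### A frontier forces the core to be c-acyclic -/

/-- The unrolled structure: elements carry a level, and levels have to increase along the
oriented cycle described by the relation `N`. -/
def unroll (A : PStruct S ar k) (N : IncV A → IncV A → Prop) (n : ℕ) : PStruct S ar k where
  dom := A.dom × Fin (n + 1)
  finite := inferInstance
  facts R := {t | ∃ h : (fun i => (t i).1) ∈ A.facts R,
    (∀ j, (∃ i, (t j).1 = A.dist i) → (t j).2 = 0) ∧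
    ∀ i j, N (Sum.inr (Sum.inl ⟨R, ⟨_, h⟩, i⟩)) (Sum.inr (Sum.inr ⟨R, ⟨_, h⟩⟩)) →
      N (Sum.inr (Sum.inr ⟨R, ⟨_, h⟩⟩)) (Sum.inr (Sum.inl ⟨R, ⟨_, h⟩, j⟩)) →
      (t i).2 < (t j).2}
  dist i := (A.dist i, 0)

theorem unroll_homTo (A : PStruct S ar k) (N : IncV A → IncV A → Prop) (n : ℕ) :
    HomTo (unroll A N n) A :=
  ⟨fun x => x.1, fun _ _ ht => ht.1, fun _ => rfl⟩

theorem homTo_of_unroll {A B : PStruct S ar k} {N : IncV A → IncV A → Prop} {n : ℕ}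
    (hasymm : ∀ u v, N u v → ¬ N v u) (hdist : ∀ u v, N u v → ∀ o : Occ A,
      (u = Sum.inr (Sum.inl o) ∨ v = Sum.inr (Sum.inl o)) → ∀ i, o.elem ≠ A.dist i)
    (hn : Nat.card (A.dom → B.dom) ≤ n) (h : HomTo (unroll A N n) B) : HomTo A B := by
  classical
  obtain ⟨h, hh⟩ := h
  let col : Fin (n + 1) → (A.dom → B.dom) := fun x a =>
    if ∃ i, a = A.dist i then h (a, 0) else h (a, x)
  have hninj : ¬ Function.Injective col := by
    intro hinj
    have := Nat.card_le_card_of_injective col hinj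
    simp at this
    omega
  have hxy : ∃ x y, x < y ∧ col x = col y := by
    simp only [Function.Injective, not_forall] at hninj
    obtain ⟨x, y, hc, hne⟩ := hninj
    rcases lt_or_gt_of_ne hne with hlt | hlt
    · exact ⟨x, y, hlt, hc⟩
    · exact ⟨y, x, hlt, hc.symm⟩
  obtain ⟨x, y, hlt, hc⟩ := hxy
  refine ⟨col x, ?_, ?_⟩
  · intro R t ht
    let Out : Fin (ar R) → Prop := fun j =>
      N (Sum.inr (Sum.inr ⟨R, ⟨t, ht⟩⟩)) (Sum.inr (Sum.inl ⟨R, ⟨t, ht⟩, j⟩))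
    let t' : Fin (ar R) → (unroll A N n).dom := fun j =>
      (t j, if ∃ i, t j = A.dist i then 0 else if Out j then y else x)
    have ht' : t' ∈ (unroll A N n).facts R := by
      refine ⟨ht, fun j hj => if_pos hj, ?_⟩
      intro i j hi hj
      have hi' : ¬ ∃ l, t i = A.dist l := fun ⟨l, hl⟩ => hdist _ _ hi _ (Or.inl rfl) l hl
      have hj' : ¬ ∃ l, t j = A.dist l := fun ⟨l, hl⟩ => hdist _ _ hj _ (Or.inr rfl) l hl
      have hio : ¬ Out i := fun ho => hasymm _ _ hi ho
      have hjo : Out j := hj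
      change (if ∃ l, t i = A.dist l then (0 : Fin (n+1)) else if Out i then y else x) <
        (if ∃ l, t j = A.dist l then (0 : Fin (n+1)) else if Out j then y else x)
      rw [if_neg hi', if_neg hj', if_neg hio, if_pos hjo]
      exact hlt
    have key := hh.1 R t' ht'
    convert key using 1
    funext j
    change col x (t j) = h (t j, if ∃ i, t j = A.dist i then 0 else if Out j then y else x)
    by_cases hd : ∃ i, t j = A.dist i
    · simp only [col, if_pos hd]
    · rw [if_neg hd]
      split_ifs with ho
      · rw [hc]; simp only [col, if_neg hd]
      · simp only [col, if_neg hd]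
  · intro i
    have : ∃ l, A.dist i = A.dist l := ⟨i, rfl⟩
    simp only [col, if_pos this]
    exact hh.2 i

theorem core_section {A C : PStruct S ar k} (hA : IsCore A) {p : C.dom → A.dom}
    (hp : IsHom C A p) (h : HomTo A C) : ∃ s, IsHom A C s ∧ ∀ x, p (s x) = x := by
  obtain ⟨s, hs⟩ := h
  have hσ := hp.comp hs
  have hsurj := (hA _ hσ).1
  have hinj := Finite.injective_iff_surjective.mpr hsurj
  let σ : Equiv.Perm A.dom := Equiv.ofBijective _ ⟨hinj, hsurj⟩
  have hpow : ∀ n : ℕ, IsHom A A (fun x => (σ ^ n) x) := by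
    intro n
    induction n with
    | zero => exact isHom_id A
    | succ n ih =>
      have := ih.comp hσ
      simp only [pow_succ, Equiv.Perm.mul_apply]
      exact this
  have hpos : 0 < orderOf σ := orderOf_pos σ
  refine ⟨fun x => s ((σ ^ (orderOf σ - 1)) x), hs.comp (hpow _), ?_⟩
  intro x
  have h1 : σ ((σ ^ (orderOf σ - 1)) x) = x := by
    rw [← Equiv.Perm.mul_apply, ← pow_succ', Nat.sub_add_cancel hpos, pow_orderOf_eq_one]; rfl
  exact h1

theorem adj_elem {A : PStruct S ar k} {a : A.dom} {w : IncV A}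
    (h : (incGraph A).Adj (Sum.inl a) w) :
    ∃ o : Occ A, o.elem = a ∧ w = Sum.inr (Sum.inl o) := by
  obtain ⟨o, (⟨h1, h2⟩ | ⟨h1, h2⟩ | ⟨h1, h2⟩ | ⟨h1, h2⟩)⟩ := h
  · exact ⟨o, (Sum.inl.inj h1).symm, h2⟩
  · cases h2
  · cases h1
  · cases h2

theorem adj_occ {A : PStruct S ar k} {o : Occ A} {w : IncV A}
    (h : (incGraph A).Adj (Sum.inr (Sum.inl o)) w) :
    w = Sum.inl o.elem ∨ w = Sum.inr (Sum.inr o.fact) := by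
  obtain ⟨o', (⟨h1, h2⟩ | ⟨h1, h2⟩ | ⟨h1, h2⟩ | ⟨h1, h2⟩)⟩ := h
  · cases h1
  · obtain rfl := Sum.inl.inj (Sum.inr.inj h2); exact Or.inl h1
  · obtain rfl := Sum.inl.inj (Sum.inr.inj h1); exact Or.inr h2
  · cases Sum.inr.inj h2

theorem adj_fact {A : PStruct S ar k} {f : Fact A} {w : IncV A}
    (h : (incGraph A).Adj (Sum.inr (Sum.inr f)) w) :
    ∃ o : Occ A, o.fact = f ∧ w = Sum.inr (Sum.inl o) := by
  obtain ⟨o, (⟨h1, h2⟩ | ⟨h1, h2⟩ | ⟨h1, h2⟩ | ⟨h1, h2⟩)⟩ := h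
  · cases h1
  · cases Sum.inr.inj h2
  · cases Sum.inr.inj h1
  · exact ⟨o, (Sum.inr.inj (Sum.inr.inj h2)).symm, h1⟩

theorem not_homTo_unroll {A : PStruct S ar k} (hA : IsCore A) {N : IncV A → IncV A → Prop}
    (hadj : ∀ u v, N u v → (incGraph A).Adj u v)
    (hasymm : ∀ u v, N u v → ¬ N v u)
    (hnext : ∀ u v, N u v → ∃ w, N v w) (hne : ∃ u v, N u v) (n : ℕ) :
    ¬ HomTo A (unroll A N n) := by
  classical
  intro h
  obtain ⟨s, hs, hps⟩ := core_section hA (p := fun x : (unroll A N n).dom => x.1)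
    ⟨fun _ _ ht => ht.1, fun _ => rfl⟩ h
  -- from an element on the cycle to the next element
  have step_elem : ∀ a w, N (Sum.inl a) w → ∃ a' w', N (Sum.inl a') w' ∧ (s a).2 < (s a').2 := by
    intro a w haw
    obtain ⟨o, rfl, rfl⟩ := adj_elem (hadj _ _ haw)
    obtain ⟨w1, hw1⟩ := hnext _ _ haw
    rcases adj_occ (hadj _ _ hw1) with rfl | rfl
    · exact absurd hw1 (hasymm _ _ haw)
    obtain ⟨w2, hw2⟩ := hnext _ _ hw1
    obtain ⟨o', ho', rfl⟩ := adj_fact (hadj _ _ hw2)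
    obtain ⟨w3, hw3⟩ := hnext _ _ hw2
    rcases adj_occ (hadj _ _ hw3) with rfl | rfl
    · obtain ⟨w4, hw4⟩ := hnext _ _ hw3
      refine ⟨_, _, hw4, ?_⟩
      obtain ⟨R, ⟨t, ht⟩, i⟩ := o
      obtain ⟨R', ⟨t', ht'⟩, j⟩ := o'
      have hR : R' = R := congrArg Sigma.fst ho'
      subst hR
      have htt : t' = t := congrArg Subtype.val (eq_of_heq (Sigma.mk.inj ho').2)
      subst htt
      have hf := hs.1 _ _ ht
      obtain ⟨h1, -, h3⟩ := hf
      have e : (fun i => (s (t' i)).1) = t' := by funext i; exact hps _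
      have e1 : (⟨R', ⟨_, h1⟩⟩ : Fact A) = ⟨R', ⟨t', ht⟩⟩ := by
        refine Sigma.ext rfl (heq_of_eq (Subtype.ext e))
      have e2 : ∀ i, (⟨R', ⟨_, h1⟩, i⟩ : Occ A) = ⟨R', ⟨t', ht⟩, i⟩ := by
        intro i
        refine Sigma.ext rfl (heq_of_eq (Prod.ext (Subtype.ext e) rfl))
      refine h3 i j ?_ ?_
      · rw [e1, e2]; exact hw1
      · rw [e1, e2]; exact hw2
    · rw [ho'] at hw3
      exact absurd hw3 (hasymm _ _ hw2)
  -- there is an element on the cycle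
  have hstart : ∃ a w, N (Sum.inl a) w := by
    have hfact : ∀ f w, N (Sum.inr (Sum.inr f)) w → ∃ a w, N (Sum.inl a) w := by
      intro f w hw
      obtain ⟨o, rfl, rfl⟩ := adj_fact (hadj _ _ hw)
      obtain ⟨w1, hw1⟩ := hnext _ _ hw
      rcases adj_occ (hadj _ _ hw1) with rfl | rfl
      · obtain ⟨w2, hw2⟩ := hnext _ _ hw1
        exact ⟨_, _, hw2⟩
      · exact absurd hw1 (hasymm _ _ hw)
    obtain ⟨u, v, huv⟩ := hne
    rcases u with a | o | f
    · exact ⟨a, v, huv⟩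
    · obtain ⟨w, hw⟩ := hnext _ _ huv
      rcases adj_occ (hadj _ _ huv) with rfl | rfl
      · exact ⟨_, _, hw⟩
      · exact hfact _ _ hw
    · exact hfact _ _ huv
  obtain ⟨a₀, w₀, h₀⟩ := hstart
  obtain ⟨a, ⟨w, haw⟩, hmax⟩ := Set.exists_max_image {a : A.dom | ∃ w, N (Sum.inl a) w}
    (fun a => (s a).2) (Set.toFinite _) ⟨a₀, w₀, h₀⟩
  obtain ⟨a', w', h', hlt⟩ := step_elem a w haw
  exact absurd (hmax a' ⟨w', h'⟩) (not_le.mpr hlt)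

theorem cycle_relation {V : Type} {G : SimpleGraph V} {v : V} (c : G.Walk v v) (hc : c.IsCycle) :
    ∃ N : V → V → Prop, (∀ a b, N a b → G.Adj a b ∧ a ∈ c.support ∧ b ∈ c.support) ∧
      (∀ a b, N a b → ¬ N b a) ∧ (∀ a b, N a b → ∃ d, N b d) ∧
      (∀ a b, N a b → ∃ d, N d a) ∧ ∃ a b, N a b := by
  have h3 := hc.three_le_length
  refine ⟨fun a b => ∃ i < c.length, c.getVert i = a ∧ c.getVert (i + 1) = b, ?_, ?_, ?_, ?_, ?_⟩
  · rintro a b ⟨i, hi, rfl, rfl⟩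
    exact ⟨c.adj_getVert_succ hi, c.getVert_mem_support _, c.getVert_mem_support _⟩
  · rintro a b ⟨i, hi, rfl, rfl⟩ ⟨j, hj, h1, h2⟩
    have h0 : c.getVert 0 = c.getVert c.length := by simp
    have inj := hc.getVert_injOn
    have inj' : ∀ x y, 1 ≤ x → x ≤ c.length → 1 ≤ y → y ≤ c.length →
        c.getVert x = c.getVert y → x = y := fun x y a b a' b' h => inj ⟨a, b⟩ ⟨a', b'⟩ h
    rcases Nat.eq_zero_or_pos j with rfl | hjp
    · rw [h0] at h1
      have e1 := inj' _ _ (by omega) (by omega) (by omega) (by omega) h1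
      have e2 := inj' _ _ (by omega) (by omega) (by omega) (by omega) h2
      omega
    · have e1 := inj' _ _ (by omega) (by omega) (by omega) (by omega) h1
      rcases Nat.eq_zero_or_pos i with rfl | hip
      · rw [h0] at h2
        have e2 := inj' _ _ (by omega) (by omega) (by omega) (by omega) h2
        omega
      · have e2 := inj' _ _ (by omega) (by omega) (by omega) (by omega) h2
        omega
  · rintro a b ⟨i, hi, rfl, rfl⟩
    by_cases h : i + 1 < c.length
    · exact ⟨_, i + 1, h, rfl, rfl⟩
    · have : i + 1 = c.length := by omega
      exact ⟨_, 0, by omega, by rw [this]; simp, rfl⟩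
  · rintro a b ⟨i, hi, rfl, rfl⟩
    rcases Nat.eq_zero_or_pos i with rfl | hip
    · exact ⟨_, c.length - 1, by omega, rfl, by rw [Nat.sub_add_cancel (by omega)]; simp⟩
    · exact ⟨_, i - 1, by omega, rfl, by rw [Nat.sub_add_cancel hip]⟩
  · exact ⟨_, _, 0, by omega, rfl, rfl⟩

theorem cAcyclic_of_frontier {A : PStruct S ar k} (hA : IsCore A)
    {F : Set (PStruct S ar k)} (hF : IsFrontier Set.univ A F) : CAcyclic A := by
  intro v c hc
  by_contra hno
  obtain ⟨N, hN, hasymm, hnext, hprev, hne⟩ := cycle_relation c hc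
  obtain ⟨h1, h2, h3, h4⟩ := hF
  obtain ⟨n, hn⟩ : ∃ n, ∀ B ∈ F, Nat.card (A.dom → B.dom) ≤ n := by
    obtain ⟨n, hn⟩ := (h1.image fun B => Nat.card (A.dom → B.dom)).bddAbove
    exact ⟨n, fun B hB => hn ⟨B, hB, rfl⟩⟩
  obtain ⟨B, hB, hCB⟩ := h4 (unroll A N n) (Set.mem_univ _) (unroll_homTo A N n)
    (not_homTo_unroll hA (fun u v h => (hN u v h).1) hasymm hnext hne n)
  refine h3 B hB (homTo_of_unroll hasymm ?_ (hn B hB) hCB)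
  -- occurrences on the cycle have non-distinguished elements
  have key : ∀ u o w, N u (Sum.inr (Sum.inl o)) → N (Sum.inr (Sum.inl o)) w →
      ∀ i, o.elem ≠ A.dist i := by
    intro u o w h1 h2 i hi
    have h1' := hN _ _ h1
    have h2' := hN _ _ h2
    apply hno
    rcases adj_occ h1'.1.symm with rfl | rfl
    · exact ⟨i, hi ▸ h1'.2.1⟩
    · rcases adj_occ h2'.1 with rfl | rfl
      · exact ⟨i, hi ▸ h2'.2.2⟩
      · exact absurd h2 (hasymm _ _ h1)
  rintro u v huv o (rfl | rfl)
  · obtain ⟨d, hd⟩ := hprev _ _ huv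
    exact key _ _ _ hd huv
  · obtain ⟨d, hd⟩ := hnext _ _ huv
    exact key _ _ _ huv hd

/-! ### Leaf facts in c-acyclic structures -/

theorem exists_cycle_in {V : Type} [Finite V] {G : SimpleGraph V} {W : Set V} (hW : W.Nonempty)
    (h2 : ∀ v ∈ W, ∃ a ∈ W, ∃ b ∈ W, a ≠ b ∧ G.Adj v a ∧ G.Adj v b) :
    ∃ (v : V) (c : G.Walk v v), c.IsCycle ∧ ∀ x ∈ c.support, x ∈ W := by
  classical
  let H := G.induce W
  have hnac : ¬ H.IsAcyclic := by
    intro hac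
    have : Nonempty W := hW.to_subtype
    obtain ⟨u, v, p, hp, hmax⟩ := SimpleGraph.Walk.exists_isPath_forall_isPath_length_le_length H
    have hsup : ∀ w, H.Adj u w → w = p.snd := by
      intro w hw
      refine hac.eq_snd_of_adj_start hp hw ?_
      by_contra hns
      have := hmax _ _ (SimpleGraph.Walk.cons hw.symm p) (hp.cons hns)
      simp at this
    obtain ⟨a, ha, b, hb, hab, hua, hub⟩ := h2 u.1 u.2
    have e1 := hsup ⟨a, ha⟩ hua
    have e2 := hsup ⟨b, hb⟩ hub
    exact hab (congrArg Subtype.val (e1.trans e2.symm))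
  simp only [SimpleGraph.IsAcyclic, not_forall, not_not] at hnac
  obtain ⟨v, c, hc⟩ := hnac
  refine ⟨_, c.map (SimpleGraph.Embedding.induce (G := G) W).toHom,
    hc.map (SimpleGraph.Embedding.induce (G := G) W).injective, ?_⟩
  intro x hx
  rw [SimpleGraph.Walk.support_map, List.mem_map] at hx
  obtain ⟨y, -, rfl⟩ := hx
  exact y.2

instance finite_fact [Finite S] (A : PStruct S ar k) : Finite (Fact A) := by
  unfold Fact; infer_instance

instance finite_occ [Finite S] (A : PStruct S ar k) : Finite (Occ A) := by
  unfold Occ; infer_instance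

instance finite_incV [Finite S] (A : PStruct S ar k) : Finite (IncV A) := by
  unfold IncV; infer_instance

/-- An occurrence whose element is not distinguished and occurs elsewhere in `U`. -/
def Shared (A : PStruct S ar k) (U : Set (Fact A)) (o : Occ A) : Prop :=
  (∀ i, o.elem ≠ A.dist i) ∧ ∃ o' : Occ A, o' ≠ o ∧ o'.fact ∈ U ∧ o'.elem = o.elem

theorem exists_leaf [Finite S] {A : PStruct S ar k} (hA : CAcyclic A) {U : Set (Fact A)}
    (hU : U.Nonempty) : ∃ f ∈ U, ∀ o o' : Occ A, o.fact = f → o'.fact = f →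
      Shared A U o → Shared A U o' → o = o' := by
  by_contra hcon
  push Not at hcon
  let W : Set (IncV A) := fun v =>
    match v with
    | Sum.inl a => ∃ o : Occ A, o.fact ∈ U ∧ Shared A U o ∧ o.elem = a
    | Sum.inr (Sum.inl o) => o.fact ∈ U ∧ Shared A U o
    | Sum.inr (Sum.inr f) => f ∈ U
  have hWn : W.Nonempty := by
    obtain ⟨f, hf⟩ := hU
    exact ⟨Sum.inr (Sum.inr f), hf⟩
  have hadj1 : ∀ o : Occ A, (incGraph A).Adj (Sum.inl o.elem) (Sum.inr (Sum.inl o)) :=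
    fun o => ⟨o, Or.inl ⟨rfl, rfl⟩⟩
  have hadj2 : ∀ o : Occ A,
      (incGraph A).Adj (Sum.inr (Sum.inl o)) (Sum.inr (Sum.inr o.fact)) :=
    fun o => ⟨o, Or.inr (Or.inr (Or.inl ⟨rfl, rfl⟩))⟩
  obtain ⟨v, c, hc, hcW⟩ := exists_cycle_in (G := incGraph A) hWn (by
    rintro (a | o | f) hv
    · obtain ⟨o, ho, hs, rfl⟩ := hv
      obtain ⟨hnd, o', hne, ho', he⟩ := hs
      have hs' : Shared A U o' := ⟨fun i => he ▸ hnd i, o, hne.symm, ho, he.symm⟩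
      refine ⟨Sum.inr (Sum.inl o), ⟨ho, hnd, o', hne, ho', he⟩, Sum.inr (Sum.inl o'), ⟨ho', hs'⟩,
        ?_, hadj1 o, he ▸ hadj1 o'⟩
      intro h
      exact hne (Sum.inl.inj (Sum.inr.inj h)).symm
    · obtain ⟨ho, hs⟩ := hv
      refine ⟨Sum.inl o.elem, ⟨o, ho, hs, rfl⟩, Sum.inr (Sum.inr o.fact), ho, ?_,
        (hadj1 o).symm, hadj2 o⟩
      intro h
      cases h
    · obtain ⟨o, o', ho, ho', hs, hs', hne⟩ := hcon f hv
      refine ⟨Sum.inr (Sum.inl o), ⟨ho ▸ hv, hs⟩, Sum.inr (Sum.inl o'), ⟨ho' ▸ hv, hs'⟩, ?_,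
        ho ▸ (hadj2 o).symm, ho' ▸ (hadj2 o').symm⟩
      intro h
      exact hne (Sum.inl.inj (Sum.inr.inj h)))
  obtain ⟨i, hi⟩ := hA v c hc
  obtain ⟨o, -, hs, he⟩ := hcW _ hi
  exact hs.1 i he

/-! ### Types of elements and bounded quotients -/

/-- The finite set of types of depth `n`. -/
def Ty (S : Type) (ar : S → ℕ) (k : ℕ) : ℕ → Type
  | 0 => Set (Fin k)
  | n + 1 => Ty S ar k n × Set (Σ R : S, Fin (ar R) × (Fin (ar R) → Ty S ar k n))

theorem finite_Ty [Finite S] (n : ℕ) : Finite (Ty S ar k n) := by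
  induction n with
  | zero => unfold Ty; infer_instance
  | succ n ih => unfold Ty; infer_instance

/-- The type of depth `n` of an element. -/
def ty (C : PStruct S ar k) : (n : ℕ) → C.dom → Ty S ar k n
  | 0, c => {i : Fin k | c = C.dist i}
  | n + 1, c => (ty C n c, {p | ∃ t ∈ C.facts p.1, t p.2.1 = c ∧ p.2.2 = fun j => ty C n (t j)})

theorem ty_mono {C : PStruct S ar k} {m r : ℕ} (h : r ≤ m) {c d : C.dom}
    (hcd : ty C m c = ty C m d) : ty C r c = ty C r d := by
  induction h with
  | refl => exact hcd
  | step _ ih => exact ih (congrArg Prod.fst hcd)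

theorem ty_dist {C : PStruct S ar k} {m : ℕ} {c : C.dom} {i : Fin k}
    (h : ty C m c = ty C m (C.dist i)) : c = C.dist i := by
  have h0 := ty_mono (Nat.zero_le m) h
  have : i ∈ {i : Fin k | C.dist i = C.dist i} := rfl
  have h1 : {j : Fin k | c = C.dist j} = {j : Fin k | C.dist i = C.dist j} := h0
  have h2 : i ∈ {j : Fin k | c = C.dist j} := by rw [h1]; rfl
  exact h2

theorem ty_fact {C : PStruct S ar k} {r : ℕ} {R : S} {t : Fin (ar R) → C.dom}
    (ht : t ∈ C.facts R) (i : Fin (ar R)) {c : C.dom} (h : ty C (r + 1) c = ty C (r + 1) (t i)) :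
    ∃ t' ∈ C.facts R, t' i = c ∧ ∀ j, ty C r (t' j) = ty C r (t j) := by
  have h2 := congrArg Prod.snd h
  have hmem : (⟨R, i, fun j => ty C r (t j)⟩ :
      Σ R : S, Fin (ar R) × (Fin (ar R) → Ty S ar k r)) ∈ (ty C (r + 1) (t i)).2 :=
    ⟨t, ht, rfl, rfl⟩
  rw [← h2] at hmem
  obtain ⟨t', ht', h3, h4⟩ := hmem
  exact ⟨t', ht', h3, fun j => (congrFun h4 j).symm⟩

theorem lift_aux [Finite S] {A C : PStruct S ar k} (hA : CAcyclic A) {m : ℕ}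
    {G : A.dom → C.dom} (hGd : ∀ i, G (A.dist i) = C.dist i)
    (hGf : ∀ R, ∀ f ∈ A.facts R, ∃ t ∈ C.facts R, ∀ j, ty C m (t j) = ty C m (G (f j))) :
    ∀ (n : ℕ) (U : Set (Fact A)), U.ncard = n → ∀ r, r + n ≤ m →
      ∃ h : A.dom → C.dom, (∀ x, ty C r (h x) = ty C r (G x)) ∧
        ∀ f ∈ U, (fun j => h (f.2.1 j)) ∈ C.facts f.1 := by
  classical
  intro n
  induction n with
  | zero =>
    intro U hU r hr
    have : U = ∅ := (Set.ncard_eq_zero (Set.toFinite U)).mp hU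
    subst this
    exact ⟨G, fun _ => rfl, fun f hf => absurd hf (Set.notMem_empty f)⟩
  | succ n ih =>
    intro U hU r hr
    have hUn : U.Nonempty := by
      rw [← Set.ncard_pos (Set.toFinite U)]; omega
    obtain ⟨F, hFU, hleaf⟩ := exists_leaf hA hUn
    have hcard : (U \ {F}).ncard = n := by
      have := Set.ncard_sdiff_singleton_of_mem hFU
      omega
    obtain ⟨h', hty, hfacts⟩ := ih (U \ {F}) hcard (r + 1) (by omega)
    obtain ⟨R, f, hf⟩ := F
    obtain ⟨t, ht, htt⟩ := hGf R f hf
    let occ : Fin (ar R) → Occ A := fun j => ⟨R, ⟨f, hf⟩, j⟩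
    have hocc : ∀ i j, occ i = occ j → i = j := by
      intro i j hij
      have := eq_of_heq (Sigma.mk.inj hij).2
      exact congrArg Prod.snd this
    have ht' : ∃ t' ∈ C.facts R, (∀ j, ty C r (t' j) = ty C r (G (f j))) ∧
        ∀ i, Shared A U (occ i) → t' i = h' (f i) := by
      by_cases hs : ∃ i, Shared A U (occ i)
      · obtain ⟨i, hi⟩ := hs
        have e : ty C (r + 1) (h' (f i)) = ty C (r + 1) (t i) :=
          (hty (f i)).trans (ty_mono (by omega) (htt i)).symm
        obtain ⟨t', h1, h2, h3⟩ := ty_fact ht i e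
        refine ⟨t', h1, fun j => (h3 j).trans (ty_mono (by omega) (htt j)), ?_⟩
        intro j hj
        have := hocc _ _ (hleaf (occ j) (occ i) rfl rfl hj hi)
        subst this
        exact h2
      · exact ⟨t, ht, fun j => ty_mono (by omega) (htt j), fun i hi => absurd ⟨i, hi⟩ hs⟩
    obtain ⟨t', ht'C, ht'ty, ht's⟩ := ht'
    let P : A.dom → Fin (ar R) → Prop := fun x j =>
      f j = x ∧ (∀ i, f j ≠ A.dist i) ∧ ¬ Shared A U (occ j)
    let h : A.dom → C.dom := fun x => if hx : ∃ j, P x j then t' hx.choose else h' x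
    have hty' : ∀ x, ty C r (h' x) = ty C r (G x) := fun x => ty_mono (by omega) (hty x)
    refine ⟨h, ?_, ?_⟩
    · intro x
      by_cases hx : ∃ j, P x j
      · simp only [h, dif_pos hx]
        rw [ht'ty, hx.choose_spec.1]
      · simp only [h, dif_neg hx]
        exact hty' x
    · intro F' hF'
      by_cases hFF : F' = ⟨R, f, hf⟩
      · subst hFF
        have : (fun j => h (f j)) = t' := by
          funext j
          by_cases hx : ∃ j', P (f j) j'
          · simp only [h, dif_pos hx]
            obtain ⟨h1, h2, h3⟩ := hx.choose_spec
            by_contra hne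
            refine h3 ⟨h2, occ j, ?_, hFU, h1.symm⟩
            intro hjj
            exact hne (congrArg t' (hocc _ _ hjj).symm)
          · simp only [h, dif_neg hx]
            by_cases hd : ∃ i, f j = A.dist i
            · obtain ⟨i, hi⟩ := hd
              have e1 : t' j = C.dist i := by
                apply ty_dist (m := r)
                rw [ht'ty, hi, hGd]
              have e2 : h' (f j) = C.dist i := by
                apply ty_dist (m := r)
                rw [hty', hi, hGd]
              rw [e1, e2]
            · by_cases hs : Shared A U (occ j)
              · exact (ht's j hs).symm
              · exact absurd ⟨j, rfl, fun i hi => hd ⟨i, hi⟩, hs⟩ hx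
        change (fun j => h (f j)) ∈ C.facts R
        rw [this]
        exact ht'C
      · have : (fun j => h (F'.2.1 j)) = fun j => h' (F'.2.1 j) := by
          funext j
          have hx : ¬ ∃ j', P (F'.2.1 j) j' := by
            rintro ⟨j', h1, h2, h3⟩
            refine h3 ⟨h2, ⟨F'.1, F'.2, j⟩, ?_, hF', h1.symm⟩
            intro he
            exact hFF (congrArg Occ.fact he)
          simp only [h, dif_neg hx]
        rw [this]
        exact hfacts F' ⟨hF', hFF⟩

/-- The structures whose domain is a set of types of depth `m`. -/
def fam (S : Type) [Finite S] (ar : S → ℕ) (k m : ℕ) (p : Σ s : Set (Ty S ar k m),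
    (∀ R : S, Set (Fin (ar R) → s)) × (Fin k → s)) : PStruct S ar k where
  dom := p.1
  finite := haveI := finite_Ty (S := S) (ar := ar) (k := k) m; inferInstance
  facts := p.2.1
  dist := p.2.2

theorem exists_fam [Finite S] {A C : PStruct S ar k} (hA : CAcyclic A) {m : ℕ}
    (hm : Nat.card (Fact A) ≤ m) (hAC : ¬ HomTo A C) :
    ∃ p, HomTo C (fam S ar k m p) ∧ ¬ HomTo A (fam S ar k m p) := by
  let q : C.dom → Set.range (ty C m) := fun c => ⟨ty C m c, c, rfl⟩
  refine ⟨⟨Set.range (ty C m), fun R => {u | ∃ t ∈ C.facts R, u = fun j => q (t j)},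
    fun i => q (C.dist i)⟩, ⟨q, fun R t ht => ⟨t, ht, rfl⟩, fun i => rfl⟩, ?_⟩
  rintro ⟨g, hg⟩
  apply hAC
  have hG : ∀ x, ∃ c, q c = g x := fun x => by
    obtain ⟨c, hc⟩ := (g x).2
    exact ⟨c, Subtype.ext hc⟩
  choose G hG using hG
  have hq : ∀ c d, q c = q d → ty C m c = ty C m d := fun c d h => congrArg Subtype.val h
  obtain ⟨h, h1, h2⟩ := lift_aux hA (m := m) (G := G)
    (fun i => ty_dist (hq _ _ ((hG _).trans (hg.2 i)))) (by
      intro R f hf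
      obtain ⟨t, ht, he⟩ := hg.1 R f hf
      refine ⟨t, ht, fun j => hq _ _ ?_⟩
      rw [hG]
      exact (congrFun he j).symm) _ Set.univ rfl 0 (by rw [Set.ncard_univ]; omega)
  refine ⟨h, fun R t ht => h2 ⟨R, t, ht⟩ (Set.mem_univ _), ?_⟩
  intro i
  apply ty_dist (m := 0)
  rw [h1]
  exact congrArg _ (ty_dist (hq _ _ ((hG _).trans (hg.2 i))))

theorem exists_frontier_of_cAcyclic [Finite S] {A : PStruct S ar k} (hA : CAcyclic A) :
    ∃ F, IsFrontier Set.univ A F := by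
  let m := Nat.card (Fact A)
  have := finite_Ty (S := S) (ar := ar) (k := k) m
  refine ⟨(fun p => prod A (fam S ar k m p)) '' {p | ¬ HomTo A (fam S ar k m p)},
    Set.toFinite _, ?_, ?_, ?_⟩
  · rintro _ ⟨p, -, rfl⟩
    exact prod_fst _ _
  · rintro _ ⟨p, hp, rfl⟩ h
    exact hp (h.trans (prod_snd _ _))
  · intro C _ hCA hAC
    obtain ⟨p, h1, h2⟩ := exists_fam hA (le_refl m) hAC
    exact ⟨_, ⟨p, h2, rfl⟩, homTo_prod hCA h1⟩

end PStruct

open PStruct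

/-- A finite structure has a finite frontier w.r.t. the class of all finite structures
iff it is homomorphically equivalent to a c-acyclic structure, iff its core is c-acyclic. -/
theorem stmt_3 {S : Type} [Finite S] {ar : S → ℕ} {k : ℕ} (A : PStruct S ar k) :
    ((∃ F, IsFrontier Set.univ A F) ↔
      ∃ B : PStruct S ar k, HomEquiv A B ∧ CAcyclic B) ∧
    ((∃ F, IsFrontier Set.univ A F) ↔
      ∀ B : PStruct S ar k, IsCore B → HomEquiv A B → CAcyclic B) := by
  have h12 : (∃ F, IsFrontier Set.univ A F) →
      ∀ B : PStruct S ar k, IsCore B → HomEquiv A B → CAcyclic B := by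
    rintro ⟨F, hF⟩ B hB hAB
    exact cAcyclic_of_frontier hB (hF.of_homEquiv hAB)
  have h23 : (∀ B : PStruct S ar k, IsCore B → HomEquiv A B → CAcyclic B) →
      ∃ B : PStruct S ar k, HomEquiv A B ∧ CAcyclic B := by
    intro h
    obtain ⟨B, hB, hAB⟩ := exists_core A
    exact ⟨B, hAB, h B hB hAB⟩
  have h31 : (∃ B : PStruct S ar k, HomEquiv A B ∧ CAcyclic B) →
      ∃ F, IsFrontier Set.univ A F := by
    rintro ⟨B, hAB, hB⟩
    obtain ⟨F, hF⟩ := exists_frontier_of_cAcyclic hB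
    exact ⟨F, hF.of_homEquiv hAB.symm⟩
  exact ⟨⟨fun h => h23 (h12 h), h31⟩, ⟨h12, fun h => h31 (h23 h)⟩⟩
end

section
/- Let q be a k-ary conjunctive query over schema S and C a class of k-ary conjunctive queries over S. If a pair of finite example sets (E⁺,E⁻) uniquely characterizes q with respect to C, then F = { q̂ × (B,\mathbf{b}) : (B,\mathbf{b}) ∈ E⁻ } is a frontier for the canonical structure q̂ of q with respect to the class Ĉ = { q̂' : q' ∈ C }. -/
open PStruct

/-- If `(E⁺,E⁻)` uniquely characterizes a CQ `q` (with canonical structure `Q = q̂`)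
w.r.t. a class `C` of CQs, then `{ q̂ × (B,𝐛) : (B,𝐛) ∈ E⁻ }` is a frontier for `q̂`
w.r.t. the class of canonical structures of queries in `C`. -/
theorem stmt_9 {S : Type} {ar : S → ℕ} {k : ℕ}
    (Q : PStruct S ar k) (hQ : IsCQ Q)
    (C : Set (PStruct S ar k)) (hC : ∀ Q' ∈ C, IsCQ Q')
    (Ep Em : Set (PStruct S ar k)) (hEp : Ep.Finite) (hEm : Em.Finite)
    (h : UniquelyCharacterizes Ep Em Q C) :
    IsFrontier C Q ((fun B => Q.prod B) '' Em) := by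
  obtain ⟨⟨hp, hm⟩, hu⟩ := h
  refine ⟨hEm.image _, ?_, ?_, ?_⟩
  · rintro _ ⟨B, hB, rfl⟩
    exact ⟨Prod.fst, fun R t ht => ht.1, fun i => rfl⟩
  · rintro _ ⟨B, hB, rfl⟩ ⟨g, hg1, hg2⟩
    exact hm B hB ⟨fun x => (g x).2, fun R t ht => (hg1 R t ht).2,
      fun i => congrArg Prod.snd (hg2 i)⟩
  · rintro C' hC' ⟨f, hf1, hf2⟩ hn
    by_contra hcon
    refine hn (hu C' hC' ⟨fun E hE => ?_, fun E hE => ?_⟩).1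
    · obtain ⟨g, hg1, hg2⟩ := hp E hE
      exact ⟨fun x => g (f x), fun R t ht => hg1 R _ (hf1 R t ht),
        fun i => (congrArg g (hf2 i)).trans (hg2 i)⟩
    · rintro ⟨g, hg1, hg2⟩
      exact hcon ⟨_, ⟨E, hE, rfl⟩, fun x => (f x, g x),
        fun R t ht => ⟨hf1 R t ht, hg1 R t ht⟩, fun i => Prod.ext (hf2 i) (hg2 i)⟩
end
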